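/- Let F : D(Mod-A) → D(Mod-B) be a derived equivalence of k-algebras A and B. If F(A) is isomorphic in D(Mod-B) to a complex T̄• of finitely generated projective B-modules concentrated in degrees 0 through n (for some n ≥ 0), then the quasi-inverse image F^{-1}(B) is isomorphic in D(Mod-A) to a complex T• of finitely generated projective A-modules concentrated in degrees −n through 0. -/

import Mathlib

open CategoryTheory CategoryTheory.Limits

namespace DerivedCategory

open Pretriangulated Triangulated

section Pretriangulated

variable {C : Type*} [Category* C] [HasZeroObject C] [HasShift C ℤ] [Preadditive C]
  [∀ n : ℤ, (shiftFunctor C n).Additive] [Pretriangulated C]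
  {X Y Z : C} {a : X ⟶ Y} {b : Y ⟶ Z} {c : Z ⟶ X⟦(1 : ℤ)⟧}

lemma coyoneda₂ (hT : Triangle.mk a b c ∈ distTriang C) {W : C} (f : W ⟶ Y) (hf : f ≫ b = 0) :
    ∃ g : W ⟶ X, f = g ≫ a :=
  Triangle.coyoneda_exact₂ _ hT f hf

lemma coyoneda₃ (hT : Triangle.mk a b c ∈ distTriang C) {W : C} (f : W ⟶ Z) (hf : f ≫ c = 0) :
    ∃ g : W ⟶ Y, f = g ≫ b :=
  Triangle.coyoneda_exact₃ _ hT f hf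

lemma yoneda₂ (hT : Triangle.mk a b c ∈ distTriang C) {W : C} (f : Y ⟶ W) (hf : a ≫ f = 0) :
    ∃ g : Z ⟶ W, f = b ≫ g :=
  Triangle.yoneda_exact₂ _ hT f hf

end Pretriangulated

section Abelian

universe w v u
variable {C : Type u} [Category.{v} C] [Abelian C] [HasDerivedCategory.{w} C]

lemma exists_Q_map_eq_of_isKProjective {K L : CochainComplex C ℤ} [K.IsKProjective]
    (f : Q.obj K ⟶ Q.obj L) : ∃ a : K ⟶ L, f = Q.map a := by
  obtain ⟨g, hg⟩ := (CochainComplex.IsKProjective.Qh_map_bijective K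
    ((HomotopyCategory.quotient _ _).obj L)).surjective
    ((quotientCompQhIso C).hom.app K ≫ f ≫ (quotientCompQhIso C).inv.app L)
  obtain ⟨a, rfl⟩ := (HomotopyCategory.quotient _ _).map_surjective g
  refine ⟨a, ?_⟩
  rw [← cancel_epi ((quotientCompQhIso C).hom.app K), ← quotientCompQhIso_hom_naturality, hg]
  simp

lemma eq_zero_of_isKProjective {K : CochainComplex C ℤ} [K.IsKProjective] {a b : ℤ}
    [K.IsStrictlyGE a] {Z : DerivedCategory C} [Z.IsLE b] (hab : b < a) (f : Q.obj K ⟶ Z) :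
    f = 0 := by
  obtain ⟨L, _, ⟨e⟩⟩ := exists_iso_Q_obj_of_isLE Z b
  rw [← cancel_mono e.hom, zero_comp]
  obtain ⟨g, hg⟩ := exists_Q_map_eq_of_isKProjective (f ≫ e.hom)
  have : g = 0 := by
    ext i
    by_cases hi : i < a
    · exact (K.isZero_of_isStrictlyGE a i hi).eq_of_src _ _
    · exact (L.isZero_of_isStrictlyLE b i (by lia)).eq_of_tgt _ _
  rw [hg, this, Functor.map_zero]

lemma eq_zero_of_isLE_of_isGE {Y Z : DerivedCategory C} (f : Y ⟶ Z) (a b : ℤ) (hab : a < b)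
    [Y.IsLE a] [Z.IsGE b] : f = 0 :=
  TStructure.t.zero f a b hab

lemma single_eq_zero {P : C} [Projective P] {Z : DerivedCategory C} {b : ℤ}
    [Z.IsLE b] (hb : b < 0) (f : (singleFunctor C 0).obj P ⟶ Z) : f = 0 := by
  let K := (CochainComplex.singleFunctor C 0).obj P
  have h (n : ℤ) : Projective (K.X n) := by
    by_cases hn : n = 0
    · subst hn
      exact Projective.of_iso (HomologicalComplex.singleObjXSelf (.up ℤ) 0 P).symm inferInstance
    · have : IsZero (K.X n) := HomologicalComplex.isZero_single_obj_X _ _ _ _ hn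
      exact Projective.of_iso (this.iso (isZero_zero C)).symm inferInstance
  have : K.IsKProjective := CochainComplex.isKProjective_of_projective K 0
  exact eq_zero_of_isKProjective (K := K) hb f

lemma isLE_obj₃ {X Y Z : DerivedCategory C} {a : X ⟶ Y} {b : Y ⟶ Z} {c : Z ⟶ X⟦(1 : ℤ)⟧}
    (hT : Triangle.mk a b c ∈ distTriang _) (n : ℤ)
    (h₁ : X.IsLE (n + 1)) (h₂ : Y.IsLE n) : Z.IsLE n := by
  rw [isLE_iff] at *
  intro i hi
  exact (HomologySequence.exact₃ _ hT i (i + 1)).isZero_of_both_zeros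
    ((h₂ i hi).eq_of_src _ _) ((h₁ (i + 1) (by lia)).eq_of_tgt _ _)

lemma isLE_obj₃_of_epi {X Y Z : DerivedCategory C} {a : X ⟶ Y} {b : Y ⟶ Z} {c : Z ⟶ X⟦(1 : ℤ)⟧}
    (hT : Triangle.mk a b c ∈ distTriang _) (n : ℤ)
    (h₁ : X.IsLE (n + 1)) (h₂ : Y.IsLE (n + 1))
    (h : Epi ((homologyFunctor C (n + 1)).map a)) : Z.IsLE n := by
  have h₃ := isLE_obj₃ hT (n + 1) (TStructure.t.isLE_of_le _ (n + 1) _) h₂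
  rw [isLE_iff] at *
  intro i hi
  obtain rfl | hi' := eq_or_ne i (n + 1)
  · replace h := (HomologySequence.epi_homologyMap_mor₁_iff _ hT _).1 h
    exact (HomologySequence.exact₃ _ hT (n + 1) (n + 2)).isZero_of_both_zeros
      h ((h₁ (n + 2) (by lia)).eq_of_tgt _ _)
  · exact h₃ i (by lia)

lemma isIso_homologyFunctor_map_mor₁ {X Y Z : DerivedCategory C} {a : X ⟶ Y} {b : Y ⟶ Z}
    {c : Z ⟶ X⟦(1 : ℤ)⟧}
    (hT : Triangle.mk a b c ∈ distTriang _)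
    (n : ℤ) (h₃ : Z.IsGE (n + 1)) : IsIso ((homologyFunctor C n).map a) := by
  rw [isGE_iff] at h₃
  have : Mono ((homologyFunctor C n).map a) := by
    refine (HomologySequence.mono_homologyMap_mor₁_iff _ hT  (n - 1) n).2 ?_
    exact (h₃ _ (by lia)).eq_of_src _ _
  have : Epi ((homologyFunctor C n).map a) := by
    refine (HomologySequence.epi_homologyMap_mor₁_iff _ hT _).2 ?_
    exact (h₃ _ (by lia)).eq_of_tgt _ _
  exact isIso_of_mono_of_epi _

lemma isIso_homologyFunctor_map_mor₂ {X Y Z : DerivedCategory C} {a : X ⟶ Y} {b : Y ⟶ Z}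
    {c : Z ⟶ X⟦(1 : ℤ)⟧}
    (hT : Triangle.mk a b c ∈ distTriang _)
    (n : ℤ) (h₁ : X.IsLE (n - 1)) : IsIso ((homologyFunctor C n).map b) := by
  rw [isLE_iff] at h₁
  have : Mono ((homologyFunctor C n).map b) := by
    refine (HomologySequence.mono_homologyMap_mor₂_iff _ hT _).2 ?_
    exact (h₁ _ (by lia)).eq_of_src _ _
  have : Epi ((homologyFunctor C n).map b) := by
    refine (HomologySequence.epi_homologyMap_mor₂_iff _ hT  n (n + 1)).2 ?_
    exact (h₁ _ (by lia)).eq_of_tgt _ _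
  exact isIso_of_mono_of_epi _

/-- A complex in nonpositive degrees maps to its zeroth cohomology. -/
lemma exists_triangle_single (X : DerivedCategory C) [X.IsLE 0] :
    ∃ (W : DerivedCategory C) (H : C) (a : W ⟶ X) (b : X ⟶ (singleFunctor C 0).obj H)
      (c : (singleFunctor C 0).obj H ⟶ W⟦(1 : ℤ)⟧),
      W.IsLE (-1) ∧ Triangle.mk a b c ∈ distTriang _ := by
  obtain ⟨W, V, hW, hV, a, b, c, hT⟩ := TStructure.t.exists_triangle X (-1) 0 (by simp)
  have hW : W.IsLE (-1) := ⟨hW⟩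
  have : V.IsGE 0 := ⟨hV⟩
  have : V.IsLE 0 := isLE_obj₃ hT 0 (TStructure.t.isLE_of_le _ (-1) _) inferInstance
  obtain ⟨H, ⟨e⟩⟩ := exists_iso_singleFunctor_obj_of_isGE_of_isLE V 0
  refine ⟨W, H, a, b ≫ e.hom, e.inv ≫ c, hW, ?_⟩
  refine isomorphic_distinguished _ hT _
    (Triangle.isoMk _ _ (Iso.refl W) (Iso.refl X) e.symm ?_ ?_ ?_)
  · exact (Category.comp_id a).trans (Category.id_comp a).symm
  · refine (Category.assoc b e.hom e.inv).trans ?_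
    rw [e.hom_inv_id]
    exact (Category.comp_id b).trans (Category.id_comp b).symm
  · exact (congrArg ((e.inv ≫ c) ≫ ·) ((shiftFunctor _ (1 : ℤ)).map_id W)).trans
      (Category.comp_id _)

instance : (singleFunctor C 0 ⋙ homologyFunctor C 0).Full :=
  .of_iso (singleFunctorCompHomologyFunctorIso C 0).symm

instance : (singleFunctor C 0 ⋙ homologyFunctor C 0).Faithful :=
  .of_iso (singleFunctorCompHomologyFunctorIso C 0).symm

lemma single_hom_eq_zero {P : C} [Projective P] {Y : DerivedCategory C}
    (f : (singleFunctor C 0).obj P ⟶ Y) (hf : (homologyFunctor C 0).map f = 0) : f = 0 := by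
  obtain ⟨X, Z, hX, hZ, a, b, c, hT⟩ := TStructure.t.exists_triangle Y 0 1 (by simp)
  have hX : X.IsLE 0 := ⟨hX⟩
  have hZ : Z.IsGE 1 := ⟨hZ⟩
  obtain ⟨g, rfl⟩ := coyoneda₂ hT f
    (eq_zero_of_isLE_of_isGE _ 0 1 (by simp))
  have := isIso_homologyFunctor_map_mor₁ hT 0 hZ
  rw [Functor.map_comp] at hf
  replace hf : (homologyFunctor C 0).map g = 0 := by
    rw [← cancel_mono ((homologyFunctor C 0).map a), hf, zero_comp]
  obtain ⟨T₁, H, u, v, t, h₁, hT'⟩ := exists_triangle_single X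
  have hgv : g ≫ v = 0 := by
    obtain ⟨h, hh⟩ := (singleFunctor C 0).map_surjective (g ≫ v)
    rw [← hh]
    have : h = 0 := by
      apply (singleFunctor C 0 ⋙ homologyFunctor C 0).map_injective
      rw [Functor.comp_map, hh, Functor.map_comp, hf, zero_comp, Functor.map_zero]
    rw [this, Functor.map_zero]
  obtain ⟨k, rfl⟩ := coyoneda₂ hT' g hgv
  rw [single_eq_zero (b := -1) (by simp) k, zero_comp, zero_comp]

lemma exists_single_hom {P : C} [Projective P] {Y : DerivedCategory C}
    (φ : (homologyFunctor C 0).obj ((singleFunctor C 0).obj P) ⟶ (homologyFunctor C 0).obj Y) :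
    ∃ f : (singleFunctor C 0).obj P ⟶ Y, (homologyFunctor C 0).map f = φ := by
  obtain ⟨X, Z, hX, hZ, a, b, c, hT⟩ := TStructure.t.exists_triangle Y 0 1 (by simp)
  have hX : X.IsLE 0 := ⟨hX⟩
  have hZ : Z.IsGE 1 := ⟨hZ⟩
  have := isIso_homologyFunctor_map_mor₁ hT 0 hZ
  obtain ⟨T₁, H, u, v, t, h₁, hT'⟩ := exists_triangle_single X
  have := isIso_homologyFunctor_map_mor₂ hT' 0 h₁
  obtain ⟨ψ, hψ⟩ := (singleFunctor C 0 ⋙ homologyFunctor C 0).map_surjective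
    (φ ≫ inv ((homologyFunctor C 0).map a) ≫ (homologyFunctor C 0).map v)
  rw [Functor.comp_map] at hψ
  have : (T₁⟦(1 : ℤ)⟧).IsLE (-2) := TStructure.t.isLE_shift T₁ (-1) 1 (-2)
  obtain ⟨g, hg⟩ := coyoneda₃ hT' ((singleFunctor C 0).map ψ)
    (single_eq_zero (b := -2) (by simp) _)
  refine ⟨g ≫ a, ?_⟩
  rw [Functor.map_comp, ← cancel_mono (inv ((homologyFunctor C 0).map a)),
    ← cancel_mono ((homologyFunctor C 0).map v)]
  simp only [Category.assoc, IsIso.hom_inv_id_assoc]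
  rw [← hψ, hg, Functor.map_comp]

end Abelian

lemma shift_map_injective {C : Type*} [Category* C] [HasShift C ℤ] [Preadditive C]
    [∀ n : ℤ, (shiftFunctor C n).Additive] (j : ℤ) {X Y : C} {f : X⟦j⟧ ⟶ Y}
    (hf : (shiftFunctorCompIsoId C j (-j) (by simp)).inv.app X ≫ f⟦-j⟧' = 0) : f = 0 := by
  apply (shiftFunctor C (-j)).map_injective
  rw [Functor.map_zero, ← cancel_epi ((shiftFunctorCompIsoId C j (-j) (by simp)).inv.app X), hf]
  exact comp_zero.symm

section Pretriangulated

variable {C : Type*} [Category* C] [HasZeroObject C] [HasShift C ℤ] [Preadditive C]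
  [∀ n : ℤ, (shiftFunctor C n).Additive] [Pretriangulated C]
  {X Y Z : C} {a : X ⟶ Y} {b : Y ⟶ Z} {c : Z ⟶ X⟦(1 : ℤ)⟧}

lemma coyoneda₂_shift (hT : Triangle.mk a b c ∈ distTriang C) (j : ℤ) {W : C} (f : W ⟶ Y⟦j⟧)
    (hf : f ≫ b⟦j⟧' = 0) : ∃ g : W ⟶ X⟦j⟧, f = g ≫ a⟦j⟧' := by
  obtain ⟨g, hg⟩ := Triangle.coyoneda_exact₂ _ (Triangle.shift_distinguished _ hT j) f
    ((Preadditive.comp_zsmul _ _ _).trans ((congrArg (j.negOnePow.val • ·) hf).trans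
      (smul_zero (A := W ⟶ Z⟦j⟧) _)))
  exact ⟨j.negOnePow • g, hg.trans ((Preadditive.comp_zsmul _ _ _).trans
    (Preadditive.zsmul_comp _ _ _).symm)⟩

lemma yoneda₂_shift (hT : Triangle.mk a b c ∈ distTriang C) (j : ℤ) {W : C} (f : Y⟦j⟧ ⟶ W)
    (hf : a⟦j⟧' ≫ f = 0) : ∃ g : Z⟦j⟧ ⟶ W, f = b⟦j⟧' ≫ g := by
  obtain ⟨g, hg⟩ := Triangle.yoneda_exact₂ _ (Triangle.shift_distinguished _ hT j) f
    ((Preadditive.zsmul_comp _ _ _).trans ((congrArg (j.negOnePow.val • ·) hf).trans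
      (smul_zero (A := X⟦j⟧ ⟶ W) _)))
  exact ⟨j.negOnePow • g, hg.trans ((Preadditive.zsmul_comp _ _ _).trans
    (Preadditive.comp_zsmul _ _ _).symm)⟩

end Pretriangulated

section Abelian

universe w v u
variable {C : Type u} [Category.{v} C] [Abelian C] [HasDerivedCategory.{w} C]

lemma shift_single_eq_zero {P N : C} [Projective P] {j : ℤ} (hj : j ≠ 0)
    (f : ((singleFunctor C 0).obj P)⟦j⟧ ⟶ (singleFunctor C 0).obj N) : f = 0 := by
  obtain hj | hj := hj.lt_or_gt
  · apply shift_map_injective j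
    have : (((singleFunctor C 0).obj N)⟦-j⟧).IsLE j := TStructure.t.isLE_shift _ 0 (-j) j
    exact single_eq_zero hj _
  · have : (((singleFunctor C 0).obj P)⟦j⟧).IsLE (-j) := TStructure.t.isLE_shift _ 0 j (-j)
    exact eq_zero_of_isLE_of_isGE f (-j) 0 (by lia)

lemma exists_projective_cover (X : DerivedCategory C) [X.IsLE 0] :
    ∃ (H : C) (b : X ⟶ (singleFunctor C 0).obj H), IsIso ((homologyFunctor C 0).map b) ∧
      ∀ (P : C) [Projective P] (π : P ⟶ H) [Epi π], ∃ (Z : DerivedCategory C)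
        (p : (singleFunctor C 0).obj P ⟶ X) (q : X ⟶ Z)
        (r : Z ⟶ ((singleFunctor C 0).obj P)⟦(1 : ℤ)⟧),
        Z.IsLE (-1) ∧ Triangle.mk p q r ∈ distTriang _ := by
  obtain ⟨W, H, a, b, c, hW, hT⟩ := exists_triangle_single X
  have hb := isIso_homologyFunctor_map_mor₂ hT 0 hW
  refine ⟨H, b, hb, fun P _ π _ ↦ ?_⟩
  have : (W⟦(1 : ℤ)⟧).IsLE (-2) := TStructure.t.isLE_shift W (-1) 1 (-2)
  obtain ⟨p, hp⟩ := coyoneda₃ hT ((singleFunctor C 0).map π)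
    (single_eq_zero (b := -2) (by simp) _)
  obtain ⟨Z, q, r, hT'⟩ := distinguished_cocone_triangle p
  refine ⟨Z, p, q, r, ?_, hT'⟩
  have h₁ : ((singleFunctor C 0).obj P).IsLE (-1 + 1) :=
    inferInstanceAs (((singleFunctor C 0).obj P).IsLE 0)
  have h₂ : X.IsLE (-1 + 1) := inferInstanceAs (X.IsLE 0)
  refine isLE_obj₃_of_epi hT' (-1) h₁ h₂ ?_
  change Epi ((homologyFunctor C 0).map p)
  have h : Epi ((homologyFunctor C 0).map p ≫ (homologyFunctor C 0).map b) := by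
    rw [← Functor.map_comp, ← hp]
    have : (singleFunctor C 0 ⋙ homologyFunctor C 0).IsEquivalence :=
      Functor.isEquivalence_of_iso (singleFunctorCompHomologyFunctorIso C 0).symm
    exact inferInstanceAs (Epi ((singleFunctor C 0 ⋙ homologyFunctor C 0).map π))
  have := epi_comp ((homologyFunctor C 0).map p ≫ (homologyFunctor C 0).map b)
    (inv ((homologyFunctor C 0).map b))
  simpa using this

end Abelian

section Module

universe w u
variable {R : Type u} [Ring R]

/-- A surjection of modules with finitely generated kernel. -/
def IsFGQuotient {N N' : ModuleCat.{u} R} (g : N ⟶ N') : Prop :=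
  Function.Surjective g.hom ∧ (LinearMap.ker g.hom).FG

lemma IsFGQuotient.id (N : ModuleCat.{u} R) : IsFGQuotient (𝟙 N) :=
  ⟨Function.surjective_id, by
    rw [ModuleCat.hom_id, LinearMap.ker_id]; exact Submodule.fg_bot⟩

lemma IsFGQuotient.comp {N N' N'' : ModuleCat.{u} R} {g : N ⟶ N'} {g' : N' ⟶ N''}
    (hg : IsFGQuotient g) (hg' : IsFGQuotient g') : IsFGQuotient (g ≫ g') :=
  ⟨hg'.1.comp hg.1, Submodule.fg_ker_comp _ _ hg.2 hg'.2 hg.1⟩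

/-- A property of modules which is inherited by enough quotients by finitely
generated submodules. -/
def HasFGQuotients (P : ObjectProperty (ModuleCat.{u} R)) : Prop :=
  ∀ N, P N → ∀ M : Submodule R N, M.FG →
    ∃ (N' : ModuleCat.{u} R) (g : N ⟶ N'), P N' ∧ IsFGQuotient g ∧ M ≤ LinearMap.ker g.hom

lemma hasFGQuotients_top : HasFGQuotients (⊤ : ObjectProperty (ModuleCat.{u} R)) :=
  fun _ _ M hM ↦ ⟨ModuleCat.of R (_ ⧸ M), ModuleCat.ofHom M.mkQ, trivial,
    ⟨M.mkQ_surjective, by simpa using hM⟩, by simp⟩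

/-- The property of being a free module. -/
def free (R : Type u) [Ring R] : ObjectProperty (ModuleCat.{u} R) := fun N ↦ Module.Free R N

lemma hasFGQuotients_free : HasFGQuotients (free R) := by
  intro N hN M hM
  have : Module.Free R N := hN
  let b := Module.Free.chooseBasis R N
  obtain ⟨J, hJ⟩ : ∃ J : Finset (Module.Free.ChooseBasisIndex R N),
      M ≤ Submodule.span R (b '' J) := by
    classical
    obtain ⟨s, rfl⟩ := hM
    refine ⟨s.biUnion fun x ↦ (b.repr x).support, Submodule.span_le.2 fun x hx ↦ ?_⟩
    refine Submodule.span_mono (Set.image_mono ?_) (b.mem_span_repr_support x)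
    exact Finset.coe_subset.2 (Finset.subset_biUnion_of_mem (fun x ↦ (b.repr x).support) hx)
  let g : N →ₗ[R] ({i // i ∉ J} →₀ R) :=
    Finsupp.lsubtypeDomain {i | i ∉ J} ∘ₗ b.repr.toLinearMap
  have hker : LinearMap.ker g = Submodule.span R (b '' J) := by
    ext x
    rw [LinearMap.mem_ker, b.mem_span_image, Finsupp.ext_iff]
    simp only [Subtype.forall]
    constructor
    · intro h i hi
      by_contra hi'
      exact Finsupp.mem_support_iff.1 hi (h i hi')
    · intro h i hi
      by_contra hi'
      exact hi (h (Finsupp.mem_support_iff.2 hi'))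
  refine ⟨ModuleCat.of R ({i // i ∉ J} →₀ R), ModuleCat.ofHom g,
    inferInstanceAs (Module.Free R ({i // i ∉ J} →₀ R)), ⟨?_, ?_⟩, hJ.trans hker.ge⟩
  · intro y
    refine ⟨b.repr.symm (y.extendDomain (P := (· ∉ J))), ?_⟩
    change Finsupp.subtypeDomain (· ∉ J) (b.repr (b.repr.symm _)) = y
    rw [b.repr.apply_symm_apply, Finsupp.subtypeDomain_extendDomain]
  · rw [ModuleCat.hom_ofHom, hker]
    exact Submodule.fg_span (J.finite_toSet.image b)

variable [HasDerivedCategory.{w} (ModuleCat.{u} R)]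

/-- Every map from a shift of `K` to a module in `P` dies in a quotient by a finitely
generated submodule. -/
def Vanishes (P : ObjectProperty (ModuleCat.{u} R)) (K : DerivedCategory (ModuleCat.{u} R)) :
    Prop :=
  ∀ N, P N → ∀ (j : ℤ) (f : K⟦j⟧ ⟶ (singleFunctor _ 0).obj N),
    ∃ (N' : ModuleCat.{u} R) (g : N ⟶ N'), P N' ∧ IsFGQuotient g ∧
      f ≫ (singleFunctor _ 0).map g = 0

variable {P : ObjectProperty (ModuleCat.{u} R)} {K X Y Z : DerivedCategory (ModuleCat.{u} R)}

lemma Vanishes.shift (hK : Vanishes P K) (i : ℤ) : Vanishes P (K⟦i⟧) := by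
  intro N hN j f
  obtain ⟨N', g, hN', hg, hfg⟩ := hK N hN (i + j) ((shiftFunctorAdd _ i j).hom.app K ≫ f)
  refine ⟨N', g, hN', hg, ?_⟩
  rw [Category.assoc] at hfg
  rw [← cancel_epi ((shiftFunctorAdd _ i j).hom.app K), hfg]
  exact comp_zero.symm

lemma Vanishes.obj₂ {a : X ⟶ Y} {b : Y ⟶ Z} {c : Z ⟶ X⟦(1 : ℤ)⟧}
    (hT : Triangle.mk a b c ∈ distTriang _) (hX : Vanishes P X) (hZ : Vanishes P Z) :
    Vanishes P Y := by
  intro N hN j f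
  obtain ⟨N₁, g₁, hN₁, hg₁, h₁⟩ := hX N hN j (a⟦j⟧' ≫ f)
  obtain ⟨h, hh⟩ := yoneda₂_shift hT j (f ≫ (singleFunctor _ 0).map g₁)
    (by rw [← Category.assoc, h₁])
  obtain ⟨N₂, g₂, hN₂, hg₂, h₂⟩ := hZ N₁ hN₁ j h
  refine ⟨N₂, g₁ ≫ g₂, hN₂, hg₁.comp hg₂, ?_⟩
  rw [Functor.map_comp, ← Category.assoc, hh, Category.assoc, h₂, comp_zero]

lemma Vanishes.single (hP : HasFGQuotients P) (L : ModuleCat.{u} R) [Module.Finite R L]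
    [Projective L] : Vanishes P ((singleFunctor _ 0).obj L) := by
  intro N hN j f
  by_cases hj : j = 0
  · subst hj
    obtain ⟨h, hh⟩ : ∃ h : L ⟶ N, (singleFunctor _ 0).map h =
        (shiftFunctorZero (DerivedCategory (ModuleCat.{u} R)) ℤ).inv.app
          ((singleFunctor _ 0).obj L) ≫ f := (singleFunctor _ 0).map_surjective _
    obtain ⟨N', g, hN', hg, hM⟩ := hP N hN (LinearMap.range h.hom)
      (Module.Finite.iff_fg.1 inferInstance)
    refine ⟨N', g, hN', hg, ?_⟩
    have : h ≫ g = 0 := by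
      ext x
      exact hM (LinearMap.mem_range_self _ x)
    rw [← cancel_epi ((shiftFunctorZero (DerivedCategory (ModuleCat.{u} R)) ℤ).inv.app
        ((singleFunctor _ 0).obj L)),
      ← Category.assoc, ← hh, ← Functor.map_comp, this, Functor.map_zero]
    exact comp_zero.symm
  · exact ⟨N, 𝟙 N, hN, .id N, by rw [shift_single_eq_zero hj f, zero_comp]⟩

end Module

section Module

universe w u
variable {R : Type u} [Ring R]

lemma projective_ker {N N' : ModuleCat.{u} R} [Module.Projective R N] [Module.Projective R N']
    (g : N →ₗ[R] N') (hg : Function.Surjective g) : Module.Projective R (LinearMap.ker g) := by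
  obtain ⟨s, hs⟩ := Module.projective_lifting_property g LinearMap.id hg
  have hs' (x) : g (s x) = x := LinearMap.congr_fun hs x
  refine Module.Projective.of_split (LinearMap.ker g).subtype
    (LinearMap.codRestrict _ (LinearMap.id - s ∘ₗ g) (fun x ↦ by simp [hs'])) ?_
  ext x
  simp

variable [HasDerivedCategory.{w} (ModuleCat.{u} R)]
  {K L M X Y : DerivedCategory (ModuleCat.{u} R)}

/-- A morphism along which vanishing is inherited by the source, and such that the maps
to modules which vanish after composition with it vanish in a quotient by a finitely generated
submodule. -/
structure IsVanishingCover (s : K ⟶ X) : Prop where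
  vanishes : Vanishes (free R) X → Vanishes (free R) K
  exists_quotient (N : ModuleCat.{u} R) (j : ℤ) (f : X⟦j⟧ ⟶ (singleFunctor _ 0).obj N)
    (hf : s⟦j⟧' ≫ f = 0) : ∃ (N' : ModuleCat.{u} R) (g : N ⟶ N'), IsFGQuotient g ∧
      f ≫ (singleFunctor _ 0).map g = 0

lemma IsVanishingCover.id (X : DerivedCategory (ModuleCat.{u} R)) : IsVanishingCover (𝟙 X) where
  vanishes := fun h ↦ h
  exists_quotient N j f hf := by
    rw [CategoryTheory.Functor.map_id] at hf
    exact ⟨N, 𝟙 N, .id N, by rw [(Category.id_comp f).symm.trans hf, zero_comp]⟩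

lemma IsVanishingCover.comp {s : L ⟶ K} {t : K ⟶ X} (hs : IsVanishingCover s)
    (ht : IsVanishingCover t) : IsVanishingCover (s ≫ t) where
  vanishes := fun h ↦ hs.vanishes (ht.vanishes h)
  exists_quotient N j f hf := by
    rw [Functor.map_comp, Category.assoc] at hf
    obtain ⟨N₁, g₁, hg₁, h₁⟩ := hs.exists_quotient N j _ hf
    obtain ⟨N₂, g₂, hg₂, h₂⟩ := ht.exists_quotient N₁ j (f ≫ (singleFunctor _ 0).map g₁)
      (by rw [← Category.assoc, h₁])
    exact ⟨N₂, g₁ ≫ g₂, hg₁.comp hg₂, by rw [Functor.map_comp, ← Category.assoc, h₂]⟩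

lemma IsVanishingCover.of_triangle {s : K ⟶ X} {b : X ⟶ M} {c : M ⟶ K⟦(1 : ℤ)⟧}
    (hT : Triangle.mk s b c ∈ distTriang _) (hM : ∀ P, HasFGQuotients P → Vanishes P M) :
    IsVanishingCover s where
  vanishes h :=
    Vanishes.obj₂ (X := M⟦(-1 : ℤ)⟧) (inv_rot_of_distTriang _ hT)
      ((hM _ hasFGQuotients_free).shift _) h
  exists_quotient N j f hf := by
    obtain ⟨g, rfl⟩ := yoneda₂_shift hT j f hf
    obtain ⟨N', q, -, hq, h⟩ := hM _ hasFGQuotients_top N trivial j g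
    exact ⟨N', q, hq, by rw [Category.assoc, h, comp_zero]⟩

lemma exists_shift_comp_eq_zero {P : ObjectProperty (ModuleCat.{u} R)} (hK : Vanishes P K)
    {N : ModuleCat.{u} R} (hN : P N) (e : ℤ) (f : K ⟶ ((singleFunctor _ 0).obj N)⟦e⟧) :
    ∃ (N' : ModuleCat.{u} R) (g : N ⟶ N'), P N' ∧ IsFGQuotient g ∧
      f ≫ ((singleFunctor _ 0).map g)⟦e⟧' = 0 := by
  obtain ⟨N', g, hN', hg, h⟩ := hK N hN (-e) (f⟦-e⟧' ≫
    (shiftFunctorCompIsoId (DerivedCategory (ModuleCat.{u} R)) e (-e) (by simp)).hom.app _)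
  refine ⟨N', g, hN', hg, (shiftFunctor _ (-e)).map_injective ?_⟩
  rw [Functor.map_zero, Functor.map_comp, ← cancel_mono ((shiftFunctorCompIsoId
    (DerivedCategory (ModuleCat.{u} R)) e (-e) (by simp)).hom.app _), zero_comp, ← h,
    Category.assoc, Category.assoc]
  exact congrArg _ ((shiftFunctorCompIsoId
    (DerivedCategory (ModuleCat.{u} R)) e (-e) (by simp)).hom.naturality _)

/-- The dévissage: a map from `X` to a bounded above object dies on a vanishing cover of `X`. -/
lemma exists_isVanishingCover (hX : Vanishes (free R) X) (c : ℤ)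
    (h₀ : ∀ Y : DerivedCategory (ModuleCat.{u} R), Y.IsLE c → ∀ f : X ⟶ Y, f = 0) (m : ℕ) :
    ∀ Y : DerivedCategory (ModuleCat.{u} R), Y.IsLE (c + m) → ∀ f : X ⟶ Y,
      ∃ (K : DerivedCategory (ModuleCat.{u} R)) (s : K ⟶ X), IsVanishingCover s ∧
        s ≫ f = 0 := by
  induction m with
  | zero =>
    intro Y hY f
    exact ⟨X, 𝟙 X, .id X, by rw [h₀ Y (by simpa using hY) f, comp_zero]⟩
  | succ m ih =>
    suffices h : ∀ (e : ℤ), -e ≤ c + (m + 1 : ℕ) →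
        ∀ Y : DerivedCategory (ModuleCat.{u} R), Y.IsLE 0 → ∀ f : X ⟶ Y⟦e⟧,
        ∃ (K : DerivedCategory (ModuleCat.{u} R)) (s : K ⟶ X), IsVanishingCover s ∧
          s ≫ f = 0 by
      intro Y hY f
      generalize hd : c + (m + 1 : ℕ) = d at hY h
      let i := shiftFunctorCompIsoId (DerivedCategory (ModuleCat.{u} R)) d (-d) (by simp)
      obtain ⟨K, s, hs, hsf⟩ := h (-d) (by simp) _ (TStructure.t.isLE_shift Y d d 0)
        (f ≫ i.inv.app Y)
      refine ⟨K, s, hs, ?_⟩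
      rw [← cancel_mono (i.inv.app Y), Category.assoc, hsf]
      exact zero_comp.symm
    intro e he Y hY f
    obtain ⟨H, -, -, hcov⟩ := exists_projective_cover Y
    let P := ModuleCat.of R (H →₀ R)
    let π : P ⟶ H := ModuleCat.ofHom (Finsupp.linearCombination R id)
    have : Epi π := (ModuleCat.epi_iff_surjective _).2 (Finsupp.linearCombination_id_surjective R H)
    have hP : Module.Free R P := inferInstanceAs (Module.Free R (H →₀ R))
    obtain ⟨Z, p, q, r, hZ, hT⟩ := hcov P π
    have : (Z⟦e⟧).IsLE (-1 - e) := TStructure.t.isLE_shift Z (-1) e (-1 - e)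
    obtain ⟨K, s, hs, hsf⟩ := ih (Z⟦e⟧) (TStructure.t.isLE_of_le _ (-1 - e) _) (f ≫ q⟦e⟧')
    obtain ⟨k, hk⟩ := coyoneda₂_shift hT e (s ≫ f) (by rw [Category.assoc, hsf])
    obtain ⟨N', g, hN', hg, hkg⟩ := exists_shift_comp_eq_zero (hs.vanishes hX) (N := P) hP e k
    have : Module.Projective R N' := @Module.Projective.of_free _ _ _ _ _ hN'
    have : Module.Projective R P := @Module.Projective.of_free _ _ _ _ _ hP
    let L := ModuleCat.of R (LinearMap.ker g.hom)
    have : Module.Projective R L := projective_ker g.hom hg.1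
    have : Projective L := (IsProjective.iff_projective _).1 this
    have : Module.Finite R L := Module.Finite.iff_fg.2 hg.2
    let S : ShortComplex (ModuleCat.{u} R) :=
      ShortComplex.mk (ModuleCat.ofHom (LinearMap.ker g.hom).subtype : L ⟶ P) g
        (by ext x; exact x.2)
    have hS : S.ShortExact :=
      { exact := by
          rw [ShortComplex.moduleCat_exact_iff]
          exact fun x hx ↦ ⟨⟨x, hx⟩, rfl⟩
        mono_f := (ModuleCat.mono_iff_injective _).2 Subtype.val_injective
        epi_g := (ModuleCat.epi_iff_surjective _).2 hg.1 }
    obtain ⟨l, hl⟩ := coyoneda₂_shift hS.singleTriangle_distinguished e k hkg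
    obtain ⟨K', t, r', hT'⟩ := distinguished_cocone_triangle₁ l
    refine ⟨K', t ≫ s, .comp (.of_triangle hT' fun P hP ↦ (Vanishes.single hP L).shift e) hs, ?_⟩
    have htl : t ≫ l = 0 := comp_distTriang_mor_zero₁₂ _ hT'
    rw [Category.assoc, hk, hl, ← Category.assoc, ← Category.assoc, htl, zero_comp, zero_comp]

lemma vanishes_top [X.IsLE 0] (hX : Vanishes (free R) X) (n : ℕ)
    (h₀ : ∀ Y : DerivedCategory (ModuleCat.{u} R), Y.IsLE (-n - 1) → ∀ f : X ⟶ Y, f = 0) :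
    Vanishes ⊤ X := by
  obtain ⟨K, s, hs, hs₀⟩ := exists_isVanishingCover hX (-n - 1) h₀ (n + 1) X
    (by convert ‹X.IsLE 0›; simp) (𝟙 X)
  rw [Category.comp_id] at hs₀
  intro N _ j f
  obtain ⟨N', g, hg, h⟩ := hs.exists_quotient N j f
    (by rw [hs₀, Functor.map_zero, zero_comp])
  exact ⟨N', g, trivial, hg, h⟩

lemma Vanishes.exists_finite_projective_cover [X.IsLE 0] (hX : Vanishes ⊤ X) :
    ∃ (P : ModuleCat.{u} R) (Z : DerivedCategory (ModuleCat.{u} R))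
      (p : (singleFunctor _ 0).obj P ⟶ X) (q : X ⟶ Z)
      (r : Z ⟶ ((singleFunctor _ 0).obj P)⟦(1 : ℤ)⟧), Module.Finite R P ∧ Projective P ∧
      Z.IsLE (-1) ∧ Triangle.mk p q r ∈ distTriang _ := by
  obtain ⟨H, b, hb, hcov⟩ := exists_projective_cover X
  obtain ⟨N', g, -, hg, h⟩ := hX H trivial 0
    ((shiftFunctorZero (DerivedCategory (ModuleCat.{u} R)) ℤ).hom.app X ≫ b)
  have hbg : b ≫ (singleFunctor _ 0).map g = 0 := by
    rw [Category.assoc] at h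
    rw [← cancel_epi ((shiftFunctorZero (DerivedCategory (ModuleCat.{u} R)) ℤ).hom.app X), h]
    exact comp_zero.symm
  have hg₀ : g = 0 := by
    apply (singleFunctor _ 0 ⋙ homologyFunctor _ 0).map_injective
    rw [Functor.map_zero, Functor.comp_map, ← cancel_epi ((homologyFunctor _ 0).map b),
      ← Functor.map_comp, hbg, Functor.map_zero, comp_zero]
  have hH : Module.Finite R H := by
    refine ⟨?_⟩
    have := hg.2
    rwa [hg₀, ModuleCat.hom_zero, LinearMap.ker_zero] at this
  obtain ⟨m, φ, hφ⟩ := Module.Finite.exists_fin' R H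
  have : Epi (ModuleCat.ofHom φ : ModuleCat.of R (Fin m → R) ⟶ H) :=
    (ModuleCat.epi_iff_surjective _).2 hφ
  have hP : Projective (ModuleCat.of R (Fin m → R)) :=
    (IsProjective.iff_projective _).1 (inferInstanceAs (Module.Projective R (Fin m → R)))
  obtain ⟨Z, p, q, r, hZ, hT⟩ := hcov _ (ModuleCat.ofHom φ)
  exact ⟨_, Z, p, q, r, inferInstanceAs (Module.Finite R (Fin m → R)), hP, hZ, hT⟩

end Module

section Module

universe w u
variable {R : Type u} [Ring R]

/-- The property of being a finitely generated projective module. -/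
def finiteProjective (R : Type u) [Ring R] : ObjectProperty (ModuleCat.{u} R) :=
  fun M ↦ Module.Finite R M ∧ Module.Projective R M

lemma finiteProjective.of_retract {M N : ModuleCat.{u} R} (hN : finiteProjective R N)
    (i : M ⟶ N) (r : N ⟶ M) (hir : i ≫ r = 𝟙 M) : finiteProjective R M := by
  obtain ⟨_, _⟩ := hN
  have h (x : M) : r (i x) = x := congr($hir x)
  exact ⟨Module.Finite.of_surjective r.hom fun x ↦ ⟨i x, h x⟩,
    Module.Projective.of_split i.hom r.hom (LinearMap.ext h)⟩

lemma finiteProjective.of_iso {M N : ModuleCat.{u} R} (hN : finiteProjective R N) (e : M ≅ N) :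
    finiteProjective R M :=
  hN.of_retract e.hom e.inv e.hom_inv_id

lemma finiteProjective.of_isZero {M : ModuleCat.{u} R} (hM : IsZero M) :
    finiteProjective R M := by
  have := ModuleCat.subsingleton_of_isZero hM
  exact ⟨inferInstance, @Module.Projective.of_free _ _ _ _ _ (Module.Free.of_subsingleton R M)⟩

lemma finiteProjective.biprod {M N : ModuleCat.{u} R} (hM : finiteProjective R M)
    (hN : finiteProjective R N) : finiteProjective R (M ⊞ N) := by
  obtain ⟨_, _⟩ := hM
  obtain ⟨_, _⟩ := hN
  exact finiteProjective.of_iso (N := ModuleCat.of R (M × N))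
    ⟨inferInstanceAs (Module.Finite R (M × N)), inferInstanceAs (Module.Projective R (M × N))⟩
    (ModuleCat.biprodIsoProd M N)

lemma finiteProjective.single_X {M : ModuleCat.{u} R} (hM : finiteProjective R M) (i : ℤ) :
    finiteProjective R (((CochainComplex.singleFunctor _ 0).obj M).X i) := by
  by_cases hi : i = 0
  · subst hi
    exact hM.of_iso (HomologicalComplex.singleObjXSelf (.up ℤ) 0 M)
  · exact .of_isZero (HomologicalComplex.isZero_single_obj_X (.up ℤ) _ _ _ hi)

lemma isKProjective_of_finiteProjective {T : CochainComplex (ModuleCat.{u} R) ℤ}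
    (hT : ∀ i, finiteProjective R (T.X i)) (b : ℤ) (hT' : ∀ i, b < i → IsZero (T.X i)) :
    T.IsKProjective := by
  have (i : ℤ) : Projective (T.X i) := (IsProjective.iff_projective _).1 (hT i).2
  have : T.IsStrictlyLE b := (CochainComplex.isStrictlyLE_iff _ _).2 hT'
  exact CochainComplex.isKProjective_of_projective T b

variable [HasDerivedCategory.{w} (ModuleCat.{u} R)]

theorem exists_finiteProjective_iso (n : ℕ) : ∀ (X : DerivedCategory (ModuleCat.{u} R)),
    X.IsLE 0 → Vanishes ⊤ X →
    (∀ Y : DerivedCategory (ModuleCat.{u} R), Y.IsLE (-n - 1) → ∀ f : X ⟶ Y, f = 0) →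
    ∃ T : CochainComplex (ModuleCat.{u} R) ℤ, (∀ i, finiteProjective R (T.X i)) ∧
      (∀ i : ℤ, (i < -(n : ℤ) ∨ 0 < i) → IsZero (T.X i)) ∧ Nonempty (X ≅ Q.obj T) := by
  induction n with
  | zero =>
    intro X hX hV h₀
    obtain ⟨P, Z, p, q, r, hPf, hP, hZ, hT⟩ := hV.exists_finite_projective_cover
    obtain ⟨s, hs⟩ := coyoneda₂ hT (𝟙 X) (by rw [h₀ Z (by simpa using hZ) q, comp_zero])
    have : X.IsGE 0 := by
      rw [isGE_iff]
      intro i hi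
      rw [IsZero.iff_id_eq_zero, ← CategoryTheory.Functor.map_id, hs, Functor.map_comp,
        (isZero_of_isGE ((singleFunctor _ 0).obj P) 0 i hi).eq_of_tgt
          ((homologyFunctor _ i).map s) 0, zero_comp]
    obtain ⟨M, ⟨e⟩⟩ := exists_iso_singleFunctor_obj_of_isGE_of_isLE X 0
    obtain ⟨i, hi⟩ := (singleFunctor _ 0).map_surjective (e.inv ≫ s)
    obtain ⟨t, ht⟩ := (singleFunctor _ 0).map_surjective (p ≫ e.hom)
    have hM : finiteProjective R M := by
      refine finiteProjective.of_retract ⟨hPf, (IsProjective.iff_projective _).2 hP⟩ i t ?_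
      apply (singleFunctor _ 0).map_injective
      rw [Functor.map_comp, hi, ht, Category.assoc, ← Category.assoc s, ← hs, Category.id_comp,
        e.inv_hom_id, CategoryTheory.Functor.map_id]
    refine ⟨(CochainComplex.singleFunctor _ 0).obj M, hM.single_X, fun i hi ↦ ?_, ⟨e⟩⟩
    exact HomologicalComplex.isZero_single_obj_X (.up ℤ) _ _ _ (by lia)
  | succ n ih =>
    intro X hX hV h₀
    obtain ⟨P, Z, p, q, r, hPf, hP, hZ, hT⟩ := hV.exists_finite_projective_cover
    have hT₁ := inv_rot_of_distTriang _ hT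
    have hT₂ := inv_rot_of_distTriang _ hT₁
    have hZ' : (Z⟦(-1 : ℤ)⟧).IsLE 0 := TStructure.t.isLE_shift Z (-1) (-1) 0
    obtain ⟨T₁, hT₁fp, hT₁conc, ⟨e⟩⟩ := ih (Z⟦(-1 : ℤ)⟧) hZ'
      (Vanishes.obj₂ (X := X⟦(-1 : ℤ)⟧) (Z := (singleFunctor _ 0).obj P) hT₂ (hV.shift _)
        (.single hasFGQuotients_top P)) (fun Y hY f ↦ by
        have hX' (g : X⟦(-1 : ℤ)⟧ ⟶ Y) : g = 0 := by
          apply shift_map_injective (-1)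
          have : (Y⟦(1 : ℤ)⟧).IsLE (-(n + 1 : ℕ) - 1) :=
            TStructure.t.isLE_shift Y (-n - 1) 1 _
          exact h₀ _ this _
        obtain ⟨g, hg⟩ := yoneda₂ (X := X⟦(-1 : ℤ)⟧) (Z := (singleFunctor _ 0).obj P) hT₂ f
          (hX' _)
        exact hg.trans ((congrArg (_ ≫ ·) (single_eq_zero (b := -n - 1) (by lia) g)).trans
          comp_zero))
    have := isKProjective_of_finiteProjective hT₁fp 0 fun i hi ↦ hT₁conc i (Or.inr hi)
    have hPfp : finiteProjective R P := ⟨hPf, (IsProjective.iff_projective _).2 hP⟩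
    let S := (CochainComplex.singleFunctor _ 0).obj P
    obtain ⟨a, ha⟩ : ∃ a : T₁ ⟶ S, e.inv ≫ (Triangle.mk p q r).invRotate.mor₁ = Q.map a :=
      exists_Q_map_eq_of_isKProjective (L := S) _
    have E := isoTriangleOfIso₁₂ _ _ hT₁ (mappingCone_triangle_distinguished a) e (Iso.refl _)
      ((Category.comp_id _).trans (e.inv_comp_eq.1 ha))
    refine ⟨CochainComplex.mappingCone a, fun i ↦ ?_, fun i hi ↦ ?_, ⟨Triangle.π₃.mapIso E⟩⟩
    · exact ((hT₁fp (i + 1)).biprod (hPfp.single_X i)).of_iso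
        (HomologicalComplex.homotopyCofiber.XIsoBiprod a i (i + 1) rfl)
    · refine IsZero.of_iso ?_ (HomologicalComplex.homotopyCofiber.XIsoBiprod a i (i + 1) rfl)
      rw [biprod_isZero_iff]
      exact ⟨hT₁conc _ (by lia),
        HomologicalComplex.isZero_single_obj_X (.up ℤ) _ _ _ (by lia)⟩

end Module

section SingleModule

universe w u v'
lemma projective_of_basis {R : Type u} [Ring R] {N : ModuleCat.{u} R} {I : Type v'}
    (b : Module.Basis I R N) : Projective N :=
  (IsProjective.iff_projective _).1 (Module.Projective.of_basis b)

variable {R : Type u} [Ring R] [HasDerivedCategory.{w} (ModuleCat.{u} R)]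

instance projective_of_self : Projective (ModuleCat.of R R) :=
  (IsProjective.iff_projective _).1 (inferInstanceAs (Module.Projective R R))

lemma isZero_homology_of_forall_eq_zero (Y : DerivedCategory (ModuleCat.{u} R))
    (h : ∀ f : (singleFunctor _ 0).obj (ModuleCat.of R R) ⟶ Y, f = 0) :
    IsZero ((homologyFunctor _ 0).obj Y) := by
  have : Subsingleton ((homologyFunctor (ModuleCat.{u} R) 0).obj Y) := by
    refine subsingleton_of_forall_eq 0 fun x ↦ ?_
    let i := (singleFunctorCompHomologyFunctorIso (ModuleCat.{u} R) 0).app (ModuleCat.of R R)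
    let l : ModuleCat.of R R ⟶ (homologyFunctor _ 0).obj Y :=
      ModuleCat.ofHom (LinearMap.toSpanSingleton R _ x)
    obtain ⟨f, hf⟩ := exists_single_hom (i.hom ≫ l)
    rw [h f, Functor.map_zero, eq_comm, ← Iso.eq_inv_comp, comp_zero] at hf
    have := congr($hf (1 : R))
    simpa [l] using this
  exact ModuleCat.isZero_of_subsingleton _

lemma isZero_homology_shift_of_forall_eq_zero (Y : DerivedCategory (ModuleCat.{u} R)) (i : ℤ)
    (h : ∀ f : (singleFunctor _ 0).obj (ModuleCat.of R R) ⟶ Y⟦i⟧, f = 0) :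
    IsZero ((homologyFunctor _ i).obj Y) :=
  (isZero_homology_of_forall_eq_zero _ h).of_iso
    ((((homologyFunctor (ModuleCat.{u} R) 0).shiftIso i 0 i (by simp)).app Y).symm)

variable {N : ModuleCat.{u} R} {I : Type v'} (b : Module.Basis I R N)

/-- The map of modules in the derived category corresponding to an element of a module. -/
noncomputable def singleElement (x : N) :
    (singleFunctor _ 0).obj (ModuleCat.of R R) ⟶ (singleFunctor _ 0).obj N :=
  (singleFunctor _ 0).map (ModuleCat.ofHom (LinearMap.toSpanSingleton R N x))

lemma singleElement_injective : Function.Injective (singleElement : N → _) := by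
  intro x y h
  have := congr($((singleFunctor _ 0).map_injective h) (1 : R))
  simpa using this

lemma singleElement_comp_eq_zero {N' : ModuleCat.{u} R} {x : N} {g : N ⟶ N'} (h : g x = 0) :
    singleElement x ≫ (singleFunctor _ 0).map g = 0 := by
  have h₀ : ModuleCat.ofHom (LinearMap.toSpanSingleton R N x) ≫ g = 0 := by
    ext
    simpa using h
  rw [singleElement, ← Functor.map_comp, h₀, Functor.map_zero]

lemma singleFunctorCompHomologyFunctorIso_inv_singleElement (x : N) :
    (singleFunctorCompHomologyFunctorIso (ModuleCat.{u} R) 0).inv.app (ModuleCat.of R R) ≫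
      (homologyFunctor _ 0).map (singleElement x) =
    ModuleCat.ofHom (LinearMap.toSpanSingleton R N x) ≫
      (singleFunctorCompHomologyFunctorIso (ModuleCat.{u} R) 0).inv.app N :=
  ((singleFunctorCompHomologyFunctorIso (ModuleCat.{u} R) 0).inv.naturality
    (ModuleCat.ofHom (LinearMap.toSpanSingleton R N x))).symm

lemma single_hom_ext_of_basis {Y : DerivedCategory (ModuleCat.{u} R)}
    {f g : (singleFunctor _ 0).obj N ⟶ Y}
    (h : ∀ i, singleElement (b i) ≫ f = singleElement (b i) ≫ g) : f = g := by
  have := projective_of_basis b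
  rw [← sub_eq_zero]
  apply single_hom_eq_zero
  rw [← cancel_epi ((singleFunctorCompHomologyFunctorIso (ModuleCat.{u} R) 0).inv.app N),
    comp_zero]
  ext : 1
  refine b.ext fun i ↦ ?_
  have h₁ : (singleFunctorCompHomologyFunctorIso (ModuleCat.{u} R) 0).inv.app
      (ModuleCat.of R R) ≫ (homologyFunctor _ 0).map (singleElement (b i)) ≫
      (homologyFunctor _ 0).map (f - g) = 0 := by
    rw [← Functor.map_comp, Preadditive.comp_sub, h i, sub_self, Functor.map_zero, comp_zero]
  rw [← Category.assoc, singleFunctorCompHomologyFunctorIso_inv_singleElement,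
    Category.assoc] at h₁
  have h₂ := congr($h₁ (1 : R))
  rw [ModuleCat.comp_apply, ModuleCat.ofHom_apply, LinearMap.toSpanSingleton_apply,
    one_smul] at h₂
  exact h₂

lemma exists_single_desc_of_basis {Y : DerivedCategory (ModuleCat.{u} R)}
    (f : I → ((singleFunctor _ 0).obj (ModuleCat.of R R) ⟶ Y)) :
    ∃ g : (singleFunctor _ 0).obj N ⟶ Y, ∀ i, singleElement (b i) ≫ g = f i := by
  have := projective_of_basis b
  let ε := singleFunctorCompHomologyFunctorIso (ModuleCat.{u} R) 0
  let φ : N ⟶ (homologyFunctor _ 0).obj Y := ModuleCat.ofHom (b.constr ℤ fun i ↦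
    (ε.inv.app (ModuleCat.of R R) ≫ (homologyFunctor _ 0).map (f i)) (1 : R))
  obtain ⟨g, hg⟩ := exists_single_hom (ε.hom.app N ≫ φ)
  refine ⟨g, fun i ↦ ?_⟩
  rw [← sub_eq_zero]
  apply single_hom_eq_zero
  rw [Functor.map_sub, sub_eq_zero, Functor.map_comp, hg,
    ← cancel_epi (ε.inv.app (ModuleCat.of R R)), ← Category.assoc,
    singleFunctorCompHomologyFunctorIso_inv_singleElement, Category.assoc,
    Iso.inv_hom_id_app_assoc]
  ext
  simp [φ]

end SingleModule

section Equivalence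

universe w w' u v
variable {R : Type u} [Ring R] [HasDerivedCategory.{w} (ModuleCat.{u} R)]
  {S : Type v} [Ring S] [HasDerivedCategory.{w'} (ModuleCat.{v} S)]
  (F : DerivedCategory (ModuleCat.{u} R) ≌ DerivedCategory (ModuleCat.{v} S))
  [F.functor.CommShift ℤ] {T : CochainComplex (ModuleCat.{v} S) ℤ}

lemma eq_zero_of_forall_eq_zero
    (e : F.functor.obj ((singleFunctor _ 0).obj (ModuleCat.of R R)) ≅ Q.obj T)
    {Y : DerivedCategory (ModuleCat.{v} S)} {i : ℤ}
    (h : ∀ g : Q.obj T ⟶ Y⟦i⟧, g = 0)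
    (f : (singleFunctor _ 0).obj (ModuleCat.of R R) ⟶ (F.inverse.obj Y)⟦i⟧) : f = 0 := by
  apply F.functor.map_injective
  have := h (e.inv ≫ F.functor.map f ≫ (F.functor.commShiftIso i).hom.app (F.inverse.obj Y) ≫
    (F.counitIso.hom.app Y)⟦i⟧')
  rw [← cancel_epi e.inv,
    ← cancel_mono ((F.functor.commShiftIso i).hom.app (F.inverse.obj Y)),
    ← cancel_mono ((F.counitIso.hom.app Y)⟦i⟧'), Functor.map_zero, comp_zero, zero_comp, zero_comp]
  simpa using this

lemma isLE_inverse_obj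
    (e : F.functor.obj ((singleFunctor _ 0).obj (ModuleCat.of R R)) ≅ Q.obj T)
    [T.IsKProjective] [T.IsStrictlyGE 0]
    (Y : DerivedCategory (ModuleCat.{v} S)) [Y.IsLE 0] : (F.inverse.obj Y).IsLE 0 := by
  rw [isLE_iff]
  intro i hi
  refine isZero_homology_shift_of_forall_eq_zero _ _
    (eq_zero_of_forall_eq_zero F e fun g ↦ ?_)
  have : (Y⟦i⟧).IsLE (-i) := TStructure.t.isLE_shift _ 0 i (-i)
  exact eq_zero_of_isKProjective (a := 0) (b := -i) (by lia) g

lemma isGE_inverse_obj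
    (e : F.functor.obj ((singleFunctor _ 0).obj (ModuleCat.of R R)) ≅ Q.obj T)
    (n : ℤ) [(Q.obj T).IsLE n]
    (Y : DerivedCategory (ModuleCat.{v} S)) [Y.IsGE 0] : (F.inverse.obj Y).IsGE (-n) := by
  rw [isGE_iff]
  intro i hi
  refine isZero_homology_shift_of_forall_eq_zero _ _
    (eq_zero_of_forall_eq_zero F e fun g ↦ ?_)
  have : (Y⟦i⟧).IsGE (-i) := TStructure.t.isGE_shift _ 0 i (-i)
  exact eq_zero_of_isLE_of_isGE g n (-i) (by lia)

lemma inverse_obj_single_eq_zero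
    (e : F.functor.obj ((singleFunctor _ 0).obj (ModuleCat.of R R)) ≅ Q.obj T)
    (n : ℤ) [(Q.obj T).IsLE n] {P : ModuleCat.{v} S} [Projective P]
    (Y : DerivedCategory (ModuleCat.{u} R)) (hY : Y.IsLE (-n - 1))
    (f : F.inverse.obj ((singleFunctor _ 0).obj P) ⟶ Y) : f = 0 := by
  obtain ⟨A, Z, hA, hZ, a, b, c, hT⟩ :=
    TStructure.t.exists_triangle (F.functor.obj Y) (-1) 0 (by simp)
  have hA : A.IsLE (-1) := ⟨hA⟩
  have hZ : Z.IsGE 0 := ⟨hZ⟩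
  have := isGE_inverse_obj F e n Z
  have hb : b = 0 := by
    apply F.inverse.map_injective
    rw [Functor.map_zero, ← cancel_epi (F.unitIso.hom.app Y), comp_zero]
    exact eq_zero_of_isLE_of_isGE (Y := Y) _ (-n - 1) (-n) (by lia)
  apply F.functor.map_injective
  rw [Functor.map_zero, ← cancel_epi (F.counitIso.inv.app _), comp_zero]
  obtain ⟨g, hg⟩ := coyoneda₂ hT (F.counitIso.inv.app _ ≫ F.functor.map f) (by simp [hb])
  rw [hg, single_eq_zero (b := -1) (by simp) g, zero_comp]

end Equivalence

section SumComplex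

universe v
variable {S : Type v} [Ring S] (I : Type v) (T : CochainComplex (ModuleCat.{v} S) ℤ)

/-- The direct sum of copies of a cochain complex of modules. -/
noncomputable def sumComplex : CochainComplex (ModuleCat.{v} S) ℤ where
  X n := ModuleCat.of S (I →₀ T.X n)
  d i j := ModuleCat.ofHom (Finsupp.mapRange.linearMap (T.d i j).hom)
  shape i j h := by
    rw [T.shape i j h]
    ext : 1
    exact LinearMap.ext fun x ↦ Finsupp.ext fun i ↦ by simp
  d_comp_d' i j l _ _ := by
    ext : 1
    refine LinearMap.ext fun x ↦ Finsupp.ext fun m ↦ ?_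
    exact congr($(T.d_comp_d i j l) (x m))

variable {I} in
/-- The inclusion of a summand. -/
noncomputable def inclSum (i : I) : T ⟶ sumComplex I T where
  f _ := ModuleCat.ofHom (Finsupp.lsingle i)
  comm' n m _ := by
    ext x : 2
    exact Finsupp.mapRange_single (hf := map_zero (T.d _ _).hom)

variable {I} in
/-- The projection onto a summand. -/
noncomputable def projSum (i : I) : sumComplex I T ⟶ T where
  f _ := ModuleCat.ofHom (Finsupp.lapply i)
  comm' _ _ _ := rfl

variable {I T} in
/-- The map out of a direct sum given by a family of maps. -/
noncomputable def descSum {L : CochainComplex (ModuleCat.{v} S) ℤ} (c : I → (T ⟶ L)) :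
    sumComplex I T ⟶ L where
  f n := ModuleCat.ofHom (Finsupp.lsum ℕ fun i ↦ ((c i).f n).hom)
  comm' n m _ := by
    ext : 1
    refine Finsupp.lhom_ext fun i x ↦ ?_
    have h := congr($((c i).comm n m) x)
    simp [sumComplex, -HomologicalComplex.Hom.comm]
    exact h

variable {I T} in
lemma inclSum_descSum {L : CochainComplex (ModuleCat.{v} S) ℤ} (c : I → (T ⟶ L)) (i : I) :
    inclSum T i ≫ descSum c = c i := by
  ext n x
  exact Finsupp.sum_single_index (map_zero _)

variable {I T} in
lemma exists_finset_comp_sum_eq {K : CochainComplex (ModuleCat.{v} S) ℤ} (m : ℤ)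
    (hK : ∀ i, i ≠ m → IsZero (K.X i)) [Module.Finite S (K.X m)] (a : K ⟶ sumComplex I T) :
    ∃ J : Finset I, a ≫ ∑ i ∈ J, projSum T i ≫ inclSum T i = a := by
  classical
  obtain ⟨G, hG⟩ := Module.Finite.fg_top (R := S) (M := K.X m)
  let α : K.X m →ₗ[S] (I →₀ T.X m) := (a.f m).hom
  refine ⟨G.biUnion fun x ↦ (α x).support, ?_⟩
  ext n : 1
  by_cases hn : n = m
  · subst hn
    have h (x : K.X n) : α x ∈ Finsupp.supported (T.X n) S
        (G.biUnion fun x ↦ (α x).support : Set I) := by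
      suffices Submodule.span S (G : Set (K.X n)) ≤ (Finsupp.supported (T.X n) S _).comap α from
        this (hG ▸ Submodule.mem_top)
      refine Submodule.span_le.2 fun y hy i hi ↦ ?_
      simpa using ⟨y, hy, by simpa using hi⟩
    ext x : 2
    have h' := h x
    rw [Finsupp.mem_supported, Finset.coe_subset] at h'
    have h₂ := (Finsupp.sum_of_support_subset _ h' (fun i y ↦ Finsupp.single i y)
      (by simp)).symm.trans (Finsupp.sum_single (α x))
    have h₃ : (∑ i ∈ G.biUnion fun x ↦ (α x).support, projSum T i ≫ inclSum T i).f n =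
        ∑ i ∈ G.biUnion fun x ↦ (α x).support, (projSum T i ≫ inclSum T i).f n :=
      (HomologicalComplex.eval (ModuleCat.{v} S) (.up ℤ) n).map_sum _ _
    exact (congr(($h₃).hom (a.f n x))).trans
      ((congr($(ModuleCat.hom_sum _ _) (a.f n x))).trans ((LinearMap.sum_apply _ _ _).trans h₂))
  · exact (hK n hn).eq_of_src _ _

end SumComplex

section Equivalence

universe w w' u v
variable {R : Type u} [Ring R] [HasDerivedCategory.{w} (ModuleCat.{u} R)]
  {S : Type v} [Ring S] [HasDerivedCategory.{w'} (ModuleCat.{v} S)]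
  (F : DerivedCategory (ModuleCat.{u} R) ≌ DerivedCategory (ModuleCat.{v} S))
  {T : CochainComplex (ModuleCat.{v} S) ℤ} [T.IsKProjective]
  {N : ModuleCat.{u} R}

lemma exists_iso_Q_obj_and_eq_Q_map
    (e : F.functor.obj ((singleFunctor _ 0).obj (ModuleCat.of R R)) ≅ Q.obj T) :
    ∃ (L : CochainComplex (ModuleCat.{v} S) ℤ)
      (l : F.functor.obj ((singleFunctor _ 0).obj N) ≅ Q.obj L) (c : N → (T ⟶ L)),
      ∀ x, Q.map (c x) = e.inv ≫ F.functor.map (singleElement x) ≫ l.hom := by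
  let l := (Q.objObjPreimageIso (F.functor.obj ((singleFunctor _ 0).obj N))).symm
  choose c hc using fun x : N ↦
    exists_Q_map_eq_of_isKProjective (e.inv ≫ F.functor.map (singleElement x) ≫ l.hom)
  exact ⟨_, l, c, fun x ↦ (hc x).symm⟩

lemma small_of_equivalence
    (e : F.functor.obj ((singleFunctor _ 0).obj (ModuleCat.of R R)) ≅ Q.obj T) :
    Small.{v} N := by
  obtain ⟨L, l, c, hc⟩ := exists_iso_Q_obj_and_eq_Q_map F e (N := N)
  refine small_of_injective (f := c) fun x y h ↦ singleElement_injective ?_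
  apply F.functor.map_injective
  rw [← cancel_epi e.inv, ← cancel_mono l.hom, Category.assoc, Category.assoc, ← hc, ← hc, h]

lemma exists_finset_comp_map_eq_zero
    (e : F.functor.obj ((singleFunctor _ 0).obj (ModuleCat.of R R)) ≅ Q.obj T)
    {I : Type v} (b : Module.Basis I R N) (j : ℤ)
    (f : ((singleFunctor _ 0).obj (ModuleCat.of S S))⟦j⟧ ⟶
      F.functor.obj ((singleFunctor _ 0).obj N)) :
    ∃ J : Finset I, ∀ (N' : ModuleCat.{u} R) (g : N ⟶ N'), (∀ i ∈ J, g (b i) = 0) →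
      f ≫ F.functor.map ((singleFunctor _ 0).map g) = 0 := by
  obtain ⟨L, l, c, hc⟩ := exists_iso_Q_obj_and_eq_Q_map F e (N := N)
  let κ : Q.obj (sumComplex I T) ⟶ F.functor.obj ((singleFunctor _ 0).obj N) :=
    Q.map (descSum fun i ↦ c (b i)) ≫ l.inv
  have hκ (i : I) : Q.map (inclSum T i) ≫ κ = e.inv ≫ F.functor.map (singleElement (b i)) := by
    rw [← Functor.map_comp_assoc, inclSum_descSum, hc]
    simp
  obtain ⟨α, hα⟩ := exists_single_desc_of_basis b fun i ↦
    F.unitIso.hom.app _ ≫ F.inverse.map (e.hom ≫ Q.map (inclSum T i))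
  let φ : F.functor.obj ((singleFunctor _ 0).obj N) ⟶ Q.obj (sumComplex I T) :=
    F.functor.map α ≫ F.counitIso.hom.app _
  have hφ (i : I) : F.functor.map (singleElement (b i)) ≫ φ = e.hom ≫ Q.map (inclSum T i) := by
    rw [← Functor.map_comp_assoc, hα]
    simp
  have hφκ : φ ≫ κ = 𝟙 _ := by
    obtain ⟨ρ, hρ⟩ := F.functor.map_surjective (φ ≫ κ)
    rw [← hρ, ← CategoryTheory.Functor.map_id]
    congr 1
    refine single_hom_ext_of_basis b fun i ↦ F.functor.map_injective ?_
    rw [Functor.map_comp, hρ, ← Category.assoc, hφ, Category.assoc, hκ, Category.comp_id,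
      Iso.hom_inv_id_assoc]
  let S₀ := (CochainComplex.singleFunctor (ModuleCat.{v} S) 0).obj (ModuleCat.of S S)
  have hS (i : ℤ) : finiteProjective S (S₀.X i) :=
    finiteProjective.single_X
      ⟨inferInstanceAs (Module.Finite S S), inferInstanceAs (Module.Projective S S)⟩ i
  have : S₀.IsKProjective := isKProjective_of_finiteProjective hS 0 fun i hi ↦
    HomologicalComplex.isZero_single_obj_X _ _ _ _ hi.ne'
  let γ : Q.obj (S₀⟦j⟧) ≅ ((singleFunctor _ 0).obj (ModuleCat.of S S))⟦j⟧ :=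
    (Q.commShiftIso j).app S₀
  obtain ⟨a, ha⟩ := exists_Q_map_eq_of_isKProjective (γ.hom ≫ f ≫ φ)
  have : Module.Finite S ((S₀⟦j⟧).X (-j)) := (hS (-j + j)).1
  obtain ⟨J, hJ⟩ := exists_finset_comp_sum_eq (-j) (fun i hi ↦
    HomologicalComplex.isZero_single_obj_X (.up ℤ) _ _ (i + j) (by lia)) a
  refine ⟨J, fun N' g hg ↦ ?_⟩
  have h (i) (hi : i ∈ J) :
      Q.map (inclSum T i) ≫ κ ≫ F.functor.map ((singleFunctor _ 0).map g) = 0 := by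
    rw [← Category.assoc, hκ, Category.assoc, ← Functor.map_comp,
      singleElement_comp_eq_zero (hg i hi), Functor.map_zero, comp_zero]
  rw [← cancel_epi γ.hom, comp_zero, ← Category.id_comp (F.functor.map _), ← hφκ,
    Category.assoc, ← Category.assoc f, ← Category.assoc γ.hom, ha, ← hJ, Functor.map_comp,
    Functor.map_sum, Category.assoc, Preadditive.sum_comp, Finset.sum_eq_zero, comp_zero]
  intro i hi
  rw [Functor.map_comp, Category.assoc, h i hi, comp_zero]

lemma vanishes_inverse_obj
    (e : F.functor.obj ((singleFunctor _ 0).obj (ModuleCat.of R R)) ≅ Q.obj T)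
    [F.functor.CommShift ℤ] :
    Vanishes (free R) (F.inverse.obj ((singleFunctor _ 0).obj (ModuleCat.of S S))) := by
  intro N hN j f
  have : Module.Free R N := hN
  cases subsingleton_or_nontrivial R
  · have := Module.subsingleton R N
    refine ⟨N, 𝟙 N, hN, .id N, ?_⟩
    rw [show 𝟙 N = 0 from (ModuleCat.isZero_of_subsingleton N).eq_of_src _ _, Functor.map_zero,
      comp_zero]
  have := small_of_equivalence F e (N := N)
  let b₀ := Module.Free.chooseBasis R N
  have : Small.{v} (Module.Free.ChooseBasisIndex R N) := small_of_injective b₀.injective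
  let b := b₀.reindex (equivShrink.{v} _)
  obtain ⟨J, hJ⟩ := exists_finset_comp_map_eq_zero F e b j
    ((F.counitIso.inv.app _)⟦j⟧' ≫ (F.functor.commShiftIso j).inv.app _ ≫ F.functor.map f)
  obtain ⟨N', g, hN', hg, hgJ⟩ := hasFGQuotients_free N hN (Submodule.span R (b '' J))
    (Submodule.fg_span (J.finite_toSet.image b))
  refine ⟨N', g, hN', hg, F.functor.map_injective ?_⟩
  have h := hJ N' g fun i hi ↦ hgJ (Submodule.subset_span ⟨i, hi, rfl⟩)
  rw [Functor.map_comp, Functor.map_zero, ← cancel_epi ((F.functor.commShiftIso j).inv.app _),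
    ← cancel_epi ((F.counitIso.inv.app _)⟦j⟧'), comp_zero, comp_zero]
  simpa using h

end Equivalence

end DerivedCategory

/-- Let `F` be a derived equivalence (a triangle equivalence
between the unbounded derived categories of right module categories) of
`k`-algebras `A` and `B`.  If `F(A)` is isomorphic in `D(Mod-B)` to a bounded
complex `T̄` of finitely generated projective `B`-modules concentrated in
degrees `0,…,n` (for some `n ≥ 0`), then `F⁻¹(B)` is isomorphic in `D(Mod-A)`
to a bounded complex `T` of finitely generated projective `A`-modules
concentrated in degrees `-n,…,0`.

Right `A`-modules are formalized as left modules over the opposite algebra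
`Aᵐᵒᵖ`. -/
theorem stmt19 (k : Type*) [CommRing k] (A B : Type*) [Ring A] [Ring B]
    [Algebra k A] [Algebra k B]
    [HasDerivedCategory (ModuleCat Aᵐᵒᵖ)] [HasDerivedCategory (ModuleCat Bᵐᵒᵖ)]
    (F : DerivedCategory (ModuleCat Aᵐᵒᵖ) ≌ DerivedCategory (ModuleCat Bᵐᵒᵖ))
    [F.functor.CommShift ℤ] [F.functor.IsTriangulated]
    (n : ℕ)
    (T' : CochainComplex (ModuleCat Bᵐᵒᵖ) ℤ)
    (hT'fg : ∀ i : ℤ, Module.Finite Bᵐᵒᵖ (T'.X i))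
    (hT'proj : ∀ i : ℤ, Module.Projective Bᵐᵒᵖ (T'.X i))
    (hT'conc : ∀ i : ℤ, (i < 0 ∨ (n : ℤ) < i) → IsZero (T'.X i))
    (hFA : Nonempty
      (F.functor.obj ((DerivedCategory.singleFunctor (ModuleCat Aᵐᵒᵖ) 0).obj
          (ModuleCat.of Aᵐᵒᵖ Aᵐᵒᵖ)) ≅ DerivedCategory.Q.obj T')) :
    ∃ T : CochainComplex (ModuleCat Aᵐᵒᵖ) ℤ,
      (∀ i : ℤ, Module.Finite Aᵐᵒᵖ (T.X i)) ∧
      (∀ i : ℤ, Module.Projective Aᵐᵒᵖ (T.X i)) ∧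
      (∀ i : ℤ, (i < -(n : ℤ) ∨ 0 < i) → IsZero (T.X i)) ∧
      Nonempty
        (F.inverse.obj ((DerivedCategory.singleFunctor (ModuleCat Bᵐᵒᵖ) 0).obj
            (ModuleCat.of Bᵐᵒᵖ Bᵐᵒᵖ)) ≅ DerivedCategory.Q.obj T) := by
  obtain ⟨e⟩ := hFA
  have hT' (i : ℤ) : DerivedCategory.finiteProjective Bᵐᵒᵖ (T'.X i) := ⟨hT'fg i, hT'proj i⟩
  have : T'.IsKProjective := DerivedCategory.isKProjective_of_finiteProjective hT' n
    fun i hi ↦ hT'conc i (.inr hi)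
  have : T'.IsStrictlyGE 0 := (CochainComplex.isStrictlyGE_iff _ _).2
    fun i hi ↦ hT'conc i (.inl hi)
  have : T'.IsStrictlyLE n := (CochainComplex.isStrictlyLE_iff _ _).2
    fun i hi ↦ hT'conc i (.inr hi)
  have hX := DerivedCategory.isLE_inverse_obj F e
    ((DerivedCategory.singleFunctor (ModuleCat Bᵐᵒᵖ) 0).obj (ModuleCat.of Bᵐᵒᵖ Bᵐᵒᵖ))
  have h₀ := DerivedCategory.inverse_obj_single_eq_zero F e n (P := ModuleCat.of Bᵐᵒᵖ Bᵐᵒᵖ)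
  obtain ⟨T, hT, hT₀, hXT⟩ := DerivedCategory.exists_finiteProjective_iso n _ hX
    (DerivedCategory.vanishes_top (DerivedCategory.vanishes_inverse_obj F e) n h₀) h₀
  exact ⟨T, fun i ↦ (hT i).1, fun i ↦ (hT i).2, hT₀, hXT⟩
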